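/- Colorful Helly theorem for discrete sets: Let S ⊆ ℝ^d be a discrete set (S has no accumulation points in ℝ^d, i.e., every bounded subset of ℝ^d contains only finitely many points of S) and let N ∈ ℕ be such that h(S) ≤ N. Then for all finite nonempty families 𝓕₁, …, 𝓕_N of closed convex subsets of ℝ^d, if every rainbow subfamily (one set chosen from each 𝓕ᵢ) has a common point belonging to S, then there exists an index i such that all the sets of 𝓕ᵢ have a common point belonging to S. -/

import Mathlib

def HellyLe {d : ℕ} (S : Set (EuclideanSpace ℝ (Fin d))) (n : ℕ) : Prop :=
  ∀ (m : ℕ) (F : Fin m → Set (EuclideanSpace ℝ (Fin d))),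
    (∀ i, Convex ℝ (F i)) →
    (∀ I : Finset (Fin m), I.card ≤ n → (S ∩ ⋂ i ∈ I, F i).Nonempty) →
    (S ∩ ⋂ i, F i).Nonempty

/-- A finite set in a real vector space is separated by a single linear functional. -/
theorem Set.Finite.exists_dual_injOn {E : Type*} [AddCommGroup E] [Module ℝ E] {S : Set E}
    (hS : S.Finite) : ∃ φ : E →ₗ[ℝ] ℝ, S.InjOn φ := by
  have : Finite S := hS
  obtain ⟨φ, hφ⟩ := Module.exists_dual_forall_apply_ne_zero (K := ℝ)
    (fun p : {p : S × S // p.1 ≠ p.2} ↦ (p.1.1 - p.1.2 : E))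
    (fun p h ↦ p.2 (Subtype.ext (sub_eq_zero.1 h)))
  refine ⟨φ, fun x hx y hy hxy ↦ by_contra fun hne ↦ ?_⟩
  refine hφ ⟨(⟨x, hx⟩, ⟨y, hy⟩), fun h ↦ hne (congrArg Subtype.val h)⟩ ?_
  simp [hxy]

theorem HellyLe.inter_convex {d n : ℕ} {S C : Set (EuclideanSpace ℝ (Fin d))}
    (hS : HellyLe S n) (hC : Convex ℝ C) : HellyLe (S ∩ C) n := by
  intro m F hF hI
  rcases isEmpty_or_nonempty (Fin m) with hm | ⟨⟨i₀⟩⟩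
  · simpa using hI ∅ (by simp)
  · obtain ⟨x, hxS, hx⟩ := hS m (fun i ↦ F i ∩ C) (fun i ↦ (hF i).inter hC) fun I hcard ↦ by
      obtain ⟨x, ⟨hxS, hxC⟩, hx⟩ := hI I hcard
      simp only [Set.mem_iInter] at hx
      exact ⟨x, hxS, by simpa only [Set.mem_iInter] using fun i hi ↦ ⟨hx i hi, hxC⟩⟩
    simp only [Set.mem_iInter] at hx
    exact ⟨x, ⟨hxS, (hx i₀).2⟩, by simpa only [Set.mem_iInter] using fun i ↦ (hx i).1⟩

/-- Colorful Helly theorem for a finite set of points, with no closedness assumption.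
The color classes may be infinite. -/
theorem HellyLe.colorful_of_finite {d N : ℕ} {S : Set (EuclideanSpace ℝ (Fin d))}
    (hS : HellyLe S N) (hfin : S.Finite)
    (𝓕 : Fin N → Set (Set (EuclideanSpace ℝ (Fin d)))) (hne : ∀ i, (𝓕 i).Nonempty)
    (hconv : ∀ i, ∀ K ∈ 𝓕 i, Convex ℝ K)
    (hrainbow : ∀ g : Fin N → Set (EuclideanSpace ℝ (Fin d)),
      (∀ i, g i ∈ 𝓕 i) → ∃ x ∈ S, ∀ i, x ∈ g i) :
    ∃ i, ∃ x ∈ S, ∀ K ∈ 𝓕 i, x ∈ K := by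
  choose g₀ hg₀ using hne
  obtain ⟨φ, hφ⟩ := hfin.exists_dual_injOn
  rcases isEmpty_or_nonempty (Fin N) with hN | ⟨⟨i₀⟩⟩
  · obtain ⟨x, hx, -⟩ := hrainbow g₀ hg₀
    have hN0 : N = 0 := by
      rcases N.eq_zero_or_pos with h | h
      · exact h
      · exact hN.elim ⟨0, h⟩
    obtain ⟨y, -, hy⟩ := hS 1 (fun _ ↦ ∅) (fun _ ↦ convex_empty) fun I hI ↦ by
      obtain rfl : I = ∅ := by simpa [hN0] using hI
      exact ⟨x, hx, by simp⟩
    simp at hy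
  -- The points of `S` in all members of a rainbow family but the one of color `i`.
  let A (i : Fin N) (g : Fin N → Set (EuclideanSpace ℝ (Fin d))) :=
    {x ∈ S | ∀ j, j ≠ i → x ∈ g j}
  have hmin (i g) (hg : ∀ j, g j ∈ 𝓕 j) : ∃ x ∈ A i g, ∀ y ∈ A i g, φ x ≤ φ y := by
    obtain ⟨x, hx, hxg⟩ := hrainbow g hg
    exact Set.exists_min_image _ φ (hfin.subset fun _ h ↦ h.1) ⟨x, hx, fun j _ ↦ hxg j⟩
  let P := {x ∈ S | ∃ i g, (∀ j, g j ∈ 𝓕 j) ∧ x ∈ A i g ∧ ∀ y ∈ A i g, φ x ≤ φ y}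
  obtain ⟨p, ⟨hpS, i, g, hg, hpA, hpmin⟩, hpmax⟩ :=
    Set.exists_max_image P φ (hfin.subset fun _ h ↦ h.1) (by
      obtain ⟨x, hx, hxmin⟩ := hmin i₀ g₀ hg₀
      exact ⟨x, hx.1, i₀, g₀, hg₀, hx, hxmin⟩)
  refine ⟨i, p, hpS, fun K hK ↦ ?_⟩
  let g' := Function.update g i K
  have hg' (j) : g' j ∈ 𝓕 j := by
    by_cases h : j = i
    · subst h; simpa [g'] using hK
    · simpa [g', h] using hg j
  obtain ⟨x, hxS, hx⟩ := hS (N + 1) (Fin.cons {y | φ y ≤ φ p} g')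
    (Fin.cases (convex_halfSpace_le φ.isLinear _) fun j ↦ hconv j _ (hg' j)) fun I hI ↦ by
      obtain ⟨k, hk⟩ : ∃ k, k ∉ I := by
        by_contra! h
        rw [Finset.eq_univ_of_forall h, Finset.card_univ, Fintype.card_fin] at hI
        omega
      simp only [Set.Nonempty, Set.mem_inter_iff, Set.mem_iInter]
      induction k using Fin.cases with
      | zero =>
        obtain ⟨x, hx, hxg⟩ := hrainbow g' hg'
        refine ⟨x, hx, Fin.cases (fun h ↦ absurd h hk) fun j _ ↦ hxg j⟩
      | succ k =>
        obtain ⟨x, hx, hxmin⟩ := hmin k g' hg'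
        refine ⟨x, hx.1, Fin.cases (fun _ ↦ hpmax x ⟨hx.1, k, g', hg', hx, hxmin⟩) fun j hj ↦ ?_⟩
        exact hx.2 j (by rintro rfl; exact hk hj)
  simp only [Set.mem_iInter] at hx
  have hxg (j) : x ∈ g' j := hx j.succ
  have hxA : x ∈ A i g := ⟨hxS, fun j hj ↦ by simpa [g', hj] using hxg j⟩
  obtain rfl : x = p := hφ hxS hpS (le_antisymm (hx 0) (hpmin x hxA))
  simpa [g'] using hxg i

/-- **Colorful Helly theorem for discrete sets.**  Let `S ⊆ ℝ^d` be discrete (every bounded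
subset of `ℝ^d` contains only finitely many points of `S`) and let `N` be such that
`h(S) ≤ N`.  Then for all finite nonempty families `𝓕₁, …, 𝓕_N` of closed convex subsets
of `ℝ^d`, if every rainbow subfamily (one set chosen from each `𝓕ᵢ`) has a common point
belonging to `S`, then there is an index `i` such that all the sets of `𝓕ᵢ` have a common
point belonging to `S`. -/
theorem colorful_helly_discrete (d N : ℕ) (S : Set (EuclideanSpace ℝ (Fin d)))
    (hdisc : ∀ B : Set (EuclideanSpace ℝ (Fin d)), Bornology.IsBounded B → (S ∩ B).Finite)
    (hHelly : HellyLe S N) :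
    ∀ 𝓕 : Fin N → Finset (Set (EuclideanSpace ℝ (Fin d))),
      (∀ i, (𝓕 i).Nonempty) →
      (∀ i, ∀ K ∈ 𝓕 i, IsClosed K ∧ Convex ℝ K) →
      (∀ g : Fin N → Set (EuclideanSpace ℝ (Fin d)),
        (∀ i, g i ∈ 𝓕 i) → (S ∩ ⋂ i, g i).Nonempty) →
      ∃ i, (S ∩ ⋂ K ∈ 𝓕 i, K).Nonempty := by
  intro 𝓕 hne hconv hrainbow
  choose! x hxS hx using hrainbow
  let T := x '' {g | ∀ i, g i ∈ 𝓕 i}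
  have hT : T.Finite := (Set.Finite.pi' fun i ↦ (𝓕 i).finite_toSet).image x
  have hTC : T ⊆ convexHull ℝ T := subset_convexHull ℝ T
  obtain ⟨i, y, hy, hyK⟩ := (hHelly.inter_convex (convex_convexHull ℝ T)).colorful_of_finite
    (hdisc _ (isBounded_convexHull.2 hT.isBounded)) (fun i ↦ {K | K ∈ 𝓕 i}) hne
    (fun i K hK ↦ (hconv i K hK).2)
    (fun g hg ↦ ⟨x g, ⟨hxS g hg, hTC ⟨g, hg, rfl⟩⟩, Set.mem_iInter.1 (hx g hg)⟩)
  exact ⟨i, y, hy.1, Set.mem_iInter₂.2 hyK⟩
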